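/- There exists a constant F > 0, depending only on σ and s, such that for every integer k ≥ 1 and every x ≥ b_{k+1}: ξ_k(x) ≤ F k^{−5/12} (x − b_k)^{−2}. -/

import Mathlib

open MeasureTheory Real Set

/-- The function `ξ_k = |x|^σ p_k(x) e^{−sx²/2}`. -/
noncomputable def xiF (σ s : ℝ) (p : ℕ → Polynomial ℝ) (k : ℕ) (x : ℝ) : ℝ :=
  |x| ^ σ * ((p k).eval x * Real.exp (-s * x ^ 2 / 2))

/-- The largest zero `b_k` of `q_k(x) = (2k+1+2σ)s − s²x² − σ̄_k x⁻²`. -/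
noncomputable def bk (σ s : ℝ) (k : ℕ) : ℝ :=
  Real.sqrt ((2 * k + 1 + 2 * σ +
    Real.sqrt ((2 * k + 1 + 2 * σ) ^ 2 - 4 * (σ * (σ - (-1 : ℝ) ^ k)))) / (2 * s))

/-- A solution of `y'' = Q y` on `[b, ∞)` with `Q x ≥ κ (x - b)` that vanishes at infinity and is
eventually positive. -/
theorem decay_of_convex_ode {y z Q : ℝ → ℝ} {b κ : ℝ} (hκ : 0 ≤ κ)
    (hy : ∀ x, b ≤ x → HasDerivAt y (z x) x)
    (hz : ∀ x, b ≤ x → HasDerivAt z (Q x * y x) x)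
    (hQ : ∀ x, b ≤ x → κ * (x - b) ≤ Q x)
    (hlim : Filter.Tendsto y Filter.atTop (nhds 0))
    (hpos : ∀ᶠ x in Filter.atTop, 0 < y x) :
    y b * z b ≤ 0 ∧ ∀ x, b ≤ x → 0 < y x ∧ y x * (1 + κ * (x - b) ^ 3 / 3) ≤ y b := by
  have hQ0 : ∀ x, b ≤ x → 0 ≤ Q x := fun x hx =>
    (mul_nonneg hκ (sub_nonneg.2 hx)).trans (hQ x hx)
  have hyc : ContinuousOn y (Ici b) := fun x hx => (hy x hx).continuousAt.continuousWithinAt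
  have hzc : ContinuousOn z (Ici b) := fun x hx => (hz x hx).continuousAt.continuousWithinAt
  have hint : ∀ {c x : ℝ}, b ≤ c → x ∈ interior (Ici c) → b ≤ x := by
    intro c x hc hx
    rw [interior_Ici] at hx
    exact hc.trans (le_of_lt hx)
  have hmono : MonotoneOn (fun x => y x * z x) (Ici b) := by
    apply monotoneOn_of_deriv_nonneg (convex_Ici b) (hyc.mul hzc)
    · intro x hx
      exact ((hy x (hint le_rfl hx)).mul
        (hz x (hint le_rfl hx))).differentiableAt.differentiableWithinAt
    · intro x hx
      have hx' := hint le_rfl hx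
      rw [((hy x hx').mul (hz x hx')).deriv]
      nlinarith [mul_nonneg (hQ0 x hx') (sq_nonneg (y x)), sq_nonneg (z x)]
  have hyz : ∀ x, b ≤ x → y x * z x ≤ 0 := by
    intro x0 hx0
    by_contra! hcon
    have hm : MonotoneOn (fun x => y x ^ 2) (Ici x0) := by
      apply monotoneOn_of_deriv_nonneg (convex_Ici x0)
        ((hyc.mono (Ici_subset_Ici.2 hx0)).pow 2)
      · intro x hx
        exact ((hy x (hint hx0 hx)).pow 2).differentiableAt.differentiableWithinAt
      · intro x hx
        have hx' := hint hx0 hx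
        have hxx : x0 ≤ x := interior_subset hx
        rw [((hy x hx').pow 2).deriv]
        have := hmono (mem_Ici.2 hx0) (mem_Ici.2 hx') hxx
        simp only at this
        norm_num
        nlinarith
    have hl : Filter.Tendsto (fun x => y x ^ 2) Filter.atTop (nhds 0) := by
      simpa using hlim.pow 2
    have : y x0 ^ 2 ≤ 0 := ge_of_tendsto hl (by
      filter_upwards [Filter.eventually_ge_atTop x0] with x hx
      exact hm (mem_Ici.2 le_rfl) (mem_Ici.2 hx) hx)
    have h0 : y x0 = 0 := by
      have := sq_nonneg (y x0)
      exact pow_eq_zero_iff (two_ne_zero) |>.1 (le_antisymm ‹_› this)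
    rw [h0] at hcon
    simp at hcon
  have hsq : AntitoneOn (fun x => y x ^ 2) (Ici b) := by
    apply antitoneOn_of_deriv_nonpos (convex_Ici b) (hyc.pow 2)
    · intro x hx
      exact ((hy x (hint le_rfl hx)).pow 2).differentiableAt.differentiableWithinAt
    · intro x hx
      have hx' := hint le_rfl hx
      rw [((hy x hx').pow 2).deriv]
      have := hyz x hx'
      norm_num
      nlinarith
  have hyp : ∀ x, b ≤ x → 0 < y x := by
    intro x hx
    by_contra! hcon
    obtain ⟨x1, h1, h1x⟩ := (hpos.and (Filter.eventually_ge_atTop x)).exists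
    obtain ⟨c, hc, hc0⟩ := intermediate_value_Icc h1x
      (hyc.mono (fun u hu => mem_Ici.2 (hx.trans hu.1))) (mem_Icc.2 ⟨hcon, h1.le⟩)
    have := hsq (mem_Ici.2 (hx.trans hc.1)) (mem_Ici.2 (hx.trans h1x)) hc.2
    simp only [hc0] at this
    nlinarith
  refine ⟨hyz b le_rfl, fun x hx => ⟨hyp x hx, ?_⟩⟩
  have hzneg : ∀ t, b ≤ t → z t ≤ 0 := fun t ht => by
    by_contra! h
    exact absurd (hyz t ht) (not_le.2 (mul_pos (hyp t ht) h))
  have hyanti : ∀ t, b ≤ t → t ≤ x → y x ≤ y t := fun t ht htx => by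
    have := hsq (mem_Ici.2 ht) (mem_Ici.2 hx) htx
    exact (pow_le_pow_iff_left₀ (hyp x hx).le (hyp t ht).le two_ne_zero).1 this
  have hd : ∀ t, b ≤ t → HasDerivAt
      (fun t => y t - (t - b) * z t + κ * y x * (t - b) ^ 3 / 3)
      (-(t - b) * (Q t * y t) + κ * y x * (t - b) ^ 2) t := by
    intro t ht
    have h1 : HasDerivAt (fun t : ℝ => t - b) 1 t := (hasDerivAt_id t).sub_const b
    have h2 := ((hy t ht).fun_sub (h1.fun_mul (hz t ht))).fun_add
      (((h1.fun_pow 3).const_mul (κ * y x)).div_const 3)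
    exact h2.congr_deriv (by norm_num; ring)
  have hH : AntitoneOn (fun t => y t - (t - b) * z t + κ * y x * (t - b) ^ 3 / 3) (Icc b x) := by
    apply antitoneOn_of_deriv_nonpos (convex_Icc b x)
    · exact fun t ht => (hd t ht.1).continuousAt.continuousWithinAt
    · intro t ht
      rw [interior_Icc] at ht
      exact (hd t ht.1.le).differentiableAt.differentiableWithinAt
    · intro t ht
      rw [interior_Icc] at ht
      rw [(hd t ht.1.le).deriv]
      have h1 := hQ t ht.1.le
      have h2 := hyanti t ht.1.le ht.2.le
      have h3 : 0 ≤ t - b := sub_nonneg.2 ht.1.le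
      have h4 : κ * (t - b) * y x ≤ Q t * y t :=
        mul_le_mul h1 h2 (hyp x hx).le (hQ0 t ht.1.le)
      nlinarith [mul_le_mul_of_nonneg_left h4 h3]
  have h := hH (left_mem_Icc.2 hx) (right_mem_Icc.2 hx) hx
  simp only [sub_self] at h
  have h5 := mul_nonneg (sub_nonneg.2 hx) (neg_nonneg.2 (hzneg x hx))
  nlinarith

/-- The multiplier identity for solutions of `y'' = -q y`. -/
theorem hasDerivAt_multiplier {y z q f f₁ f₂ : ℝ → ℝ} {x q₁ f₃ : ℝ}
    (hy : HasDerivAt y (z x) x) (hz : HasDerivAt z (-(q x * y x)) x)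
    (hq : HasDerivAt q q₁ x) (hf : HasDerivAt f (f₁ x) x) (hf₁ : HasDerivAt f₁ (f₂ x) x)
    (hf₂ : HasDerivAt f₂ f₃ x) :
    HasDerivAt (fun t => f t * z t ^ 2 + f t * q t * y t ^ 2 - f₁ t * (y t * z t)
        + f₂ t / 2 * y t ^ 2)
      ((2 * f₁ x * q x + f x * q₁ + f₃ / 2) * y x ^ 2) x := by
  have h := (((hf.fun_mul (hz.fun_pow 2)).fun_add ((hf.fun_mul hq).fun_mul (hy.fun_pow 2))).fun_sub
    (hf₁.fun_mul (hy.fun_mul hz))).fun_add ((hf₂.div_const 2).fun_mul (hy.fun_pow 2))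
  exact h.congr_deriv (by norm_num; ring)

theorem hasDerivAt_inv_sqrt_sub_sq {B x : ℝ} (h : x ^ 2 < B) :
    HasDerivAt (fun t => (√(B - t ^ 2))⁻¹) (x * (√(B - x ^ 2))⁻¹ ^ 3) x := by
  have hW : 0 < B - x ^ 2 := sub_pos.2 h
  have h1 : HasDerivAt (fun t : ℝ => B - t ^ 2) (-(2 * x)) x := by
    simpa using ((hasDerivAt_id x).fun_pow 2).const_sub B
  have hs : 0 < √(B - x ^ 2) := Real.sqrt_pos.2 hW
  refine ((h1.sqrt hW.ne').fun_inv hs.ne').congr_deriv ?_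
  field_simp

/-- Nonpositivity of the main part of the multiplier density. -/
theorem multiplier_main_nonpos {β κ s τ x v : ℝ} (hβ : 1 ≤ β) (hκ : 1 ≤ κ)
    (hs : 15 ≤ s ^ 2 * κ ^ 4) (hκβ : κ ≤ β ^ 2) (hτ : 64 * |τ| ≤ s ^ 2 * β ^ 6)
    (hx1 : β ^ 3 / 2 ≤ x) (hx2 : x ≤ β ^ 3) (hv : 0 < v)
    (hvW : v ^ 2 * (β ^ 6 + κ ^ 2 * β ^ 2 - x ^ 2) = 1) :
    2 * (x * v ^ 3) * (s ^ 2 * (β ^ 6 - x ^ 2) + τ / β ^ 6 - τ / x ^ 2)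
      + v * (-(2 * s ^ 2 * x) + 2 * τ / x ^ 3) + (9 * x * v ^ 5 + 15 * x ^ 3 * v ^ 7) / 2 ≤ 0 := by
  have hβ0 : 0 < β := by linarith
  have hb : 0 < β ^ 3 := by positivity
  have hx : 0 < x := by linarith
  have hxx : x ^ 2 ≤ β ^ 6 := by nlinarith
  have hη1 : 1 ≤ κ ^ 2 * β ^ 2 := by
    have := one_le_pow₀ (n := 2) hβ
    have := one_le_pow₀ (n := 2) hκ
    nlinarith
  have hvη : v ^ 2 * (κ ^ 2 * β ^ 2) ≤ 1 := by nlinarith [sq_nonneg v]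
  have hid : 2 * (x * v ^ 3) * (s ^ 2 * (β ^ 6 - x ^ 2) + τ / β ^ 6 - τ / x ^ 2)
      + v * (-(2 * s ^ 2 * x) + 2 * τ / x ^ 3) + (9 * x * v ^ 5 + 15 * x ^ 3 * v ^ 7) / 2
      = x * v ^ 3 * (-2 * s ^ 2 * (κ ^ 2 * β ^ 2)
        + 2 * τ / x ^ 4 * (κ ^ 2 * β ^ 2 + (β ^ 6 - x ^ 2) ^ 2 / β ^ 6)
        + 9 / 2 * v ^ 2 + 15 / 2 * x ^ 2 * v ^ 4) := by
    have : v * (-(2 * s ^ 2 * x) + 2 * τ / x ^ 3)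
        = v ^ 3 * (β ^ 6 + κ ^ 2 * β ^ 2 - x ^ 2) * (-(2 * s ^ 2 * x) + 2 * τ / x ^ 3) := by
      linear_combination (-v * (-(2 * s ^ 2 * x) + 2 * τ / x ^ 3)) * hvW
    rw [this]
    field_simp
    ring
  rw [hid]
  refine mul_nonpos_of_nonneg_of_nonpos (by positivity) ?_
  have hv1 : v ^ 2 ≤ 1 := by nlinarith [sq_nonneg v]
  have e1 : 9 / 2 * v ^ 2 ≤ s ^ 2 / 2 * (κ ^ 2 * β ^ 2) := by
    have h1 : 15 ≤ s ^ 2 * (κ ^ 2 * β ^ 2) ^ 2 := by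
      have : κ ^ 4 ≤ (κ ^ 2 * β ^ 2) ^ 2 := by
        have := one_le_pow₀ (n := 4) hβ
        have : 0 ≤ κ ^ 4 := by positivity
        nlinarith
      nlinarith [sq_nonneg s]
    have h2 : 15 * v ^ 2 ≤ s ^ 2 * (κ ^ 2 * β ^ 2) := by
      calc 15 * v ^ 2 ≤ (s ^ 2 * (κ ^ 2 * β ^ 2) ^ 2) * v ^ 2 := by gcongr
        _ = s ^ 2 * (κ ^ 2 * β ^ 2) * (v ^ 2 * (κ ^ 2 * β ^ 2)) := by ring
        _ ≤ s ^ 2 * (κ ^ 2 * β ^ 2) * 1 := by gcongr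
        _ = _ := by ring
    nlinarith [sq_nonneg v]
  have e2 : 15 / 2 * x ^ 2 * v ^ 4 ≤ s ^ 2 / 2 * (κ ^ 2 * β ^ 2) := by
    have h1 : 15 ≤ s ^ 2 * κ ^ 6 := by
      have : κ ^ 4 ≤ κ ^ 6 := pow_le_pow_right₀ hκ (by norm_num)
      nlinarith [sq_nonneg s]
    calc 15 / 2 * x ^ 2 * v ^ 4 ≤ (s ^ 2 * κ ^ 6) / 2 * β ^ 6 * v ^ 4 := by gcongr
      _ = s ^ 2 / 2 * (κ ^ 2 * β ^ 2) * (v ^ 2 * (κ ^ 2 * β ^ 2)) ^ 2 := by ring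
      _ ≤ s ^ 2 / 2 * (κ ^ 2 * β ^ 2) * 1 ^ 2 := by gcongr
      _ = _ := by ring
  have e3 : 2 * τ / x ^ 4 * (κ ^ 2 * β ^ 2 + (β ^ 6 - x ^ 2) ^ 2 / β ^ 6)
      ≤ s ^ 2 * (κ ^ 2 * β ^ 2) := by
    have h1 : (β ^ 6 - x ^ 2) ^ 2 / β ^ 6 ≤ β ^ 6 := by
      rw [div_le_iff₀ (by positivity)]
      nlinarith [sq_nonneg x]
    have h2 : κ ^ 2 * β ^ 2 ≤ β ^ 6 := by
      calc κ ^ 2 * β ^ 2 ≤ (β ^ 2) ^ 2 * β ^ 2 := by gcongr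
        _ = _ := by ring
    have h3 : 2 * τ / x ^ 4 ≤ 32 * |τ| / β ^ 12 := by
      rw [div_le_div_iff₀ (by positivity) (by positivity)]
      have : β ^ 12 ≤ 16 * x ^ 4 := by
        calc β ^ 12 = 16 * (β ^ 3 / 2) ^ 4 := by ring
          _ ≤ 16 * x ^ 4 := by gcongr
      calc 2 * τ * β ^ 12 ≤ 2 * |τ| * β ^ 12 := by gcongr; exact le_abs_self τ
        _ ≤ 2 * |τ| * (16 * x ^ 4) := by gcongr
        _ = _ := by ring
    calc 2 * τ / x ^ 4 * (κ ^ 2 * β ^ 2 + (β ^ 6 - x ^ 2) ^ 2 / β ^ 6)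
        ≤ 32 * |τ| / β ^ 12 * (β ^ 6 + β ^ 6) := by gcongr
      _ = 64 * |τ| / β ^ 6 := by field_simp; ring
      _ ≤ s ^ 2 := by rw [div_le_iff₀ (by positivity)]; exact hτ
      _ ≤ s ^ 2 * (κ ^ 2 * β ^ 2) := le_mul_of_one_le_right (sq_nonneg s) hη1
  linarith

/-- Bound for the part of the multiplier density which involves derivatives of the cutoff. -/
theorem multiplier_cutoff_le {β κ s τ x v c : ℝ} (hβ : 1 ≤ β) (hκ : 1 ≤ κ)
    (hκβ : κ ≤ β ^ 2) (hτ : 64 * |τ| ≤ s ^ 2 * β ^ 6)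
    (hx1 : β ^ 3 / 2 ≤ x) (hx2 : x ≤ β ^ 3) (hv : 0 < v)
    (hvW : v ^ 2 * (β ^ 6 + κ ^ 2 * β ^ 2 - x ^ 2) = 1) (hc0 : 0 ≤ c) (hc : c ≤ β ^ 3 / 2) :
    6 * c ^ 2 * v * (s ^ 2 * (β ^ 6 - x ^ 2) + τ / β ^ 6 - τ / x ^ 2)
      + (6 * v + 18 * c * (x * v ^ 3) + 9 * c ^ 2 * (v ^ 3 + 3 * x ^ 2 * v ^ 5)) / 2
      ≤ (6 * s ^ 2 + 15) * β ^ 9 := by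
  have hβ0 : 0 < β := by linarith
  have hb : 0 < β ^ 3 := by positivity
  have hx : 0 < x := by linarith
  have hxx : x ^ 2 ≤ β ^ 6 := by nlinarith
  have hβ2 : 1 ≤ β ^ 2 := one_le_pow₀ hβ
  have hκ2 : 1 ≤ κ ^ 2 := one_le_pow₀ hκ
  have hvη : v ^ 2 * (κ ^ 2 * β ^ 2) ≤ 1 := by nlinarith [sq_nonneg v]
  have hvβ : v * β ≤ 1 := by
    have : (v * β) ^ 2 ≤ 1 := by
      calc (v * β) ^ 2 = v ^ 2 * (1 * β ^ 2) := by ring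
        _ ≤ v ^ 2 * (κ ^ 2 * β ^ 2) := by gcongr
        _ ≤ 1 := hvη
    exact (sq_le_one_iff₀ (by positivity)).1 this
  have hv1 : v ≤ 1 := by nlinarith
  have h2 : κ ^ 2 * β ^ 2 ≤ β ^ 6 := by
    calc κ ^ 2 * β ^ 2 ≤ (β ^ 2) ^ 2 * β ^ 2 := by gcongr
      _ = _ := by ring
  set W := β ^ 6 + κ ^ 2 * β ^ 2 - x ^ 2 with hW
  have hW0 : 0 < W := by
    by_contra! h
    nlinarith [sq_nonneg v]
  have hvWb : v * W ≤ 2 * β ^ 3 := by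
    have : (v * W) ^ 2 ≤ (2 * β ^ 3) ^ 2 := by
      calc (v * W) ^ 2 = W * (v ^ 2 * W) := by ring
        _ = W := by rw [hvW, mul_one]
        _ ≤ (2 * β ^ 3) ^ 2 := by nlinarith [sq_nonneg x]
    exact (pow_le_pow_iff_left₀ (by positivity) (by positivity) two_ne_zero).1 this
  have hq : s ^ 2 * (β ^ 6 - x ^ 2) + τ / β ^ 6 - τ / x ^ 2 ≤ 2 * s ^ 2 * W := by
    have e : τ / β ^ 6 - τ / x ^ 2 = -τ / (β ^ 6 * x ^ 2) * (β ^ 6 - x ^ 2) := by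
      field_simp
      ring
    have h3 : -τ / (β ^ 6 * x ^ 2) ≤ s ^ 2 := by
      rw [div_le_iff₀ (by positivity)]
      have h4 : 1 ≤ 4 * x ^ 2 := by
        have : 1 ≤ β ^ 3 := one_le_pow₀ hβ
        nlinarith
      have h5 : -τ ≤ |τ| := neg_le_abs τ
      have h6 : s ^ 2 * β ^ 6 ≤ s ^ 2 * β ^ 6 * (4 * x ^ 2) :=
        le_mul_of_one_le_right (by positivity) h4
      have := abs_nonneg τ
      nlinarith
    have h7 : -τ / (β ^ 6 * x ^ 2) * (β ^ 6 - x ^ 2) ≤ s ^ 2 * (β ^ 6 - x ^ 2) :=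
      mul_le_mul_of_nonneg_right h3 (by linarith)
    have h8 : s ^ 2 * (β ^ 6 - x ^ 2) ≤ s ^ 2 * W := by
      apply mul_le_mul_of_nonneg_left _ (sq_nonneg s)
      rw [hW]
      nlinarith
    linarith
  have t1 : 6 * c ^ 2 * v * (s ^ 2 * (β ^ 6 - x ^ 2) + τ / β ^ 6 - τ / x ^ 2)
      ≤ 6 * s ^ 2 * β ^ 9 := by
    calc _ ≤ 6 * c ^ 2 * v * (2 * s ^ 2 * W) := by gcongr
      _ = 12 * s ^ 2 * c ^ 2 * (v * W) := by ring
      _ ≤ 12 * s ^ 2 * (β ^ 3 / 2) ^ 2 * (2 * β ^ 3) := by gcongr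
      _ = _ := by ring
  have p9 : 1 ≤ β ^ 9 := one_le_pow₀ hβ
  have p6 : β ^ 6 ≤ β ^ 9 := pow_le_pow_right₀ hβ (by norm_num)
  have p7 : β ^ 7 ≤ β ^ 9 := pow_le_pow_right₀ hβ (by norm_num)
  have t2 : 18 * c * (x * v ^ 3) ≤ 9 * β ^ 9 := by
    calc 18 * c * (x * v ^ 3) ≤ 18 * (β ^ 3 / 2) * (β ^ 3 * 1 ^ 3) := by gcongr
      _ = 9 * β ^ 6 := by ring
      _ ≤ _ := by linarith
  have t3 : 9 * c ^ 2 * v ^ 3 ≤ 9 / 4 * β ^ 9 := by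
    calc 9 * c ^ 2 * v ^ 3 ≤ 9 * (β ^ 3 / 2) ^ 2 * 1 ^ 3 := by gcongr
      _ = 9 / 4 * β ^ 6 := by ring
      _ ≤ _ := by linarith
  have t4 : 9 * c ^ 2 * (3 * x ^ 2 * v ^ 5) ≤ 27 / 4 * β ^ 9 := by
    calc 9 * c ^ 2 * (3 * x ^ 2 * v ^ 5) ≤ 9 * (β ^ 3 / 2) ^ 2 * (3 * (β ^ 3) ^ 2 * v ^ 5) := by
          gcongr
      _ = 27 / 4 * β ^ 7 * (v * β) ^ 5 := by ring
      _ ≤ 27 / 4 * β ^ 7 * 1 ^ 5 := by gcongr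
      _ ≤ _ := by linarith
  linarith

/-- A solution of `y'' = -q y` with `q x = s² (β⁶ - x²) + τ / β⁶ - τ / x²`, of mass at most one
on the left of the turning point `β³`, is `O(β^(-1/2))` at the turning point. -/
theorem sq_turning_point_le {y z : ℝ → ℝ} {β κ s τ : ℝ} (hβ : 1 ≤ β) (hκ : 1 ≤ κ)
    (hs : 15 ≤ s ^ 2 * κ ^ 4) (hκβ : κ ≤ β ^ 2) (hτ : 64 * |τ| ≤ s ^ 2 * β ^ 6)
    (hy : ∀ x, 0 < x → HasDerivAt y (z x) x)
    (hz : ∀ x, 0 < x → HasDerivAt z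
      (-((s ^ 2 * (β ^ 6 - x ^ 2) + τ / β ^ 6 - τ / x ^ 2) * y x)) x)
    (hyz : y (β ^ 3) * z (β ^ 3) ≤ 0)
    (hmass : ∫ x in (β ^ 3 / 2)..(β ^ 3), y x ^ 2 ≤ 1) :
    y (β ^ 3) ^ 2 * β ≤ 6 * κ ^ 5 * (6 * s ^ 2 + 15) := by
  have hβ0 : 0 < β := by linarith
  have hκ0 : 0 < κ := by linarith
  have hb : 0 < β ^ 3 := by positivity
  set B := β ^ 6 + κ ^ 2 * β ^ 2 with hB
  set a := β ^ 3 / 2 with ha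
  set q : ℝ → ℝ := fun x => s ^ 2 * (β ^ 6 - x ^ 2) + τ / β ^ 6 - τ / x ^ 2 with hqdef
  set v : ℝ → ℝ := fun x => (√(B - x ^ 2))⁻¹ with hvdef
  set f : ℝ → ℝ := fun x => (x - a) ^ 3 * v x with hfdef
  set f₁ : ℝ → ℝ := fun x => 3 * (x - a) ^ 2 * v x + (x - a) ^ 3 * (x * v x ^ 3) with hf1def
  set f₂ : ℝ → ℝ := fun x => 6 * (x - a) * v x + 6 * (x - a) ^ 2 * (x * v x ^ 3)
    + (x - a) ^ 3 * (v x ^ 3 + 3 * x ^ 2 * v x ^ 5) with hf2def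
  set f₃ : ℝ → ℝ := fun x => 6 * v x + 18 * (x - a) * (x * v x ^ 3)
    + 9 * (x - a) ^ 2 * (v x ^ 3 + 3 * x ^ 2 * v x ^ 5)
    + (x - a) ^ 3 * (9 * x * v x ^ 5 + 15 * x ^ 3 * v x ^ 7) with hf3def
  set q₁ : ℝ → ℝ := fun x => -(2 * s ^ 2 * x) + 2 * τ / x ^ 3 with hq1def
  have hab : a ≤ β ^ 3 := by linarith
  have hpos : ∀ x ∈ Icc a (β ^ 3), 0 < x := fun x hx => by linarith [hx.1]
  have hxB : ∀ x ∈ Icc a (β ^ 3), x ^ 2 < B := fun x hx => by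
    have h1 : 0 < κ ^ 2 * β ^ 2 := by positivity
    have h2 := hx.2
    have h3 := hpos x hx
    nlinarith
  have hv : ∀ x ∈ Icc a (β ^ 3), HasDerivAt v (x * v x ^ 3) x := fun x hx =>
    hasDerivAt_inv_sqrt_sub_sq (hxB x hx)
  have hv0 : ∀ x ∈ Icc a (β ^ 3), 0 < v x := fun x hx =>
    inv_pos.2 (Real.sqrt_pos.2 (sub_pos.2 (hxB x hx)))
  have hvW : ∀ x ∈ Icc a (β ^ 3), v x ^ 2 * (β ^ 6 + κ ^ 2 * β ^ 2 - x ^ 2) = 1 := fun x hx => by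
    have h := sub_pos.2 (hxB x hx)
    simp only [hvdef]
    rw [inv_pow, Real.sq_sqrt h.le, ← hB, inv_mul_cancel₀ h.ne']
  have hc : ∀ x : ℝ, HasDerivAt (fun x : ℝ => x - a) 1 x := fun x => (hasDerivAt_id x).sub_const a
  have hd : ∀ x ∈ Icc a (β ^ 3), HasDerivAt
      (fun t => f t * z t ^ 2 + f t * q t * y t ^ 2 - f₁ t * (y t * z t) + f₂ t / 2 * y t ^ 2)
      ((2 * f₁ x * q x + f x * q₁ x + f₃ x / 2) * y x ^ 2) x := by
    intro x hx
    have hx0 := hpos x hx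
    have hid := hasDerivAt_id' x
    refine hasDerivAt_multiplier (hy x hx0) (hz x hx0) ?_ ?_ ?_ ?_
    · have h := (((hid.fun_pow 2).const_sub (β ^ 6)).const_mul (s ^ 2)).add_const (τ / β ^ 6)
      have h' := h.fun_sub (((hid.fun_pow 2).fun_inv (by positivity)).const_mul τ)
      simp only [← div_eq_mul_inv] at h'
      refine h'.congr_deriv ?_
      simp only [hq1def]
      push_cast
      field_simp
      ring
    · exact (((hc x).fun_pow 3).fun_mul (hv x hx)).congr_deriv (by simp only [hf1def]; norm_num)
    · exact (((((hc x).fun_pow 2).const_mul 3).fun_mul (hv x hx)).fun_add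
        (((hc x).fun_pow 3).fun_mul (hid.fun_mul ((hv x hx).fun_pow 3)))).congr_deriv
        (by simp only [hf2def]; norm_num; ring)
    · exact (((((hc x).const_mul 6).fun_mul (hv x hx)).fun_add
        ((((hc x).fun_pow 2).const_mul 6).fun_mul (hid.fun_mul ((hv x hx).fun_pow 3)))).fun_add
        (((hc x).fun_pow 3).fun_mul (((hv x hx).fun_pow 3).fun_add
          (((hid.fun_pow 2).const_mul 3).fun_mul ((hv x hx).fun_pow 5))))).congr_deriv
        (by simp only [hf3def]; norm_num; ring)
  have hyc : ContinuousOn y (Icc a (β ^ 3)) := fun x hx =>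
    (hy x (hpos x hx)).continuousAt.continuousWithinAt
  have hmain := intervalIntegral.sub_le_integral_of_hasDeriv_right_of_le
    (φ := fun x => (6 * s ^ 2 + 15) * β ^ 9 * y x ^ 2) hab
    (fun x hx => (hd x hx).continuousAt.continuousWithinAt)
    (fun x hx => (hd x (Ioo_subset_Icc_self hx)).hasDerivWithinAt)
    ((continuousOn_const.mul (hyc.pow 2)).integrableOn_Icc) (by
      intro x hx
      have hx' := Ioo_subset_Icc_self hx
      refine mul_le_mul_of_nonneg_right ?_ (sq_nonneg _)
      have h1 := multiplier_main_nonpos hβ hκ hs hκβ hτ hx'.1 hx'.2 (hv0 x hx') (hvW x hx')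
      have h2 := multiplier_cutoff_le hβ hκ hκβ hτ hx'.1 hx'.2 (hv0 x hx') (hvW x hx')
        (c := x - a) (by linarith [hx'.1]) (by linarith [hx'.2])
      have h3 : 0 ≤ (x - a) ^ 3 := pow_nonneg (by linarith [hx'.1]) 3
      have h4 := mul_nonpos_of_nonneg_of_nonpos h3 h1
      refine le_trans (le_of_eq ?_) ((add_le_add h4 h2).trans_eq (zero_add _))
      simp only [hf1def, hf3def, hfdef, hqdef, hq1def]
      ring)
  have hqb : q (β ^ 3) = 0 := by
    simp only [hqdef]
    rw [← pow_mul]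
    ring
  have hfa : f a = 0 ∧ f₁ a = 0 ∧ f₂ a = 0 := by simp [hfdef, hf1def, hf2def]
  have hvb : v (β ^ 3) * (κ * β) = 1 := by
    have h := hvW _ (right_mem_Icc.2 hab)
    have h' : (v (β ^ 3) * (κ * β)) ^ 2 = 1 := by rw [← h]; ring
    have h0 := hv0 _ (right_mem_Icc.2 hab)
    exact (pow_eq_one_iff_of_nonneg (by positivity) two_ne_zero).1 h'
  rw [intervalIntegral.integral_const_mul] at hmain
  simp only [hqb, hfa.1, hfa.2.1, hfa.2.2] at hmain
  have hvb0 := hv0 _ (right_mem_Icc.2 hab)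
  have hca : β ^ 3 - a = β ^ 3 / 2 := by rw [ha]; ring
  have g1 : 0 ≤ f (β ^ 3) * z (β ^ 3) ^ 2 := by
    simp only [hfdef, hca]; positivity
  have g2 : f₁ (β ^ 3) * (y (β ^ 3) * z (β ^ 3)) ≤ 0 := by
    refine mul_nonpos_of_nonneg_of_nonpos ?_ hyz
    simp only [hf1def, hca]; positivity
  have g3 : β ^ 15 * (3 / 8) * v (β ^ 3) ^ 5 ≤ f₂ (β ^ 3) := by
    simp only [hf2def, hca]
    have : 0 ≤ 6 * (β ^ 3 / 2) * v (β ^ 3) + 6 * (β ^ 3 / 2) ^ 2 * (β ^ 3 * v (β ^ 3) ^ 3)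
      + (β ^ 3 / 2) ^ 3 * v (β ^ 3) ^ 3 := by positivity
    nlinarith
  have g4 : (6 * s ^ 2 + 15) * β ^ 9 * ∫ x in a..(β ^ 3), y x ^ 2 ≤ (6 * s ^ 2 + 15) * β ^ 9 * 1 :=
    mul_le_mul_of_nonneg_left hmass (by positivity)
  have g5 : β ^ 15 * (3 / 8) * v (β ^ 3) ^ 5 / 2 * y (β ^ 3) ^ 2 ≤ (6 * s ^ 2 + 15) * β ^ 9 := by
    have := mul_le_mul_of_nonneg_right g3 (sq_nonneg (y (β ^ 3)))
    linarith
  have g6 : β ^ 9 * (y (β ^ 3) ^ 2 * β * (3 / 16)) ≤ β ^ 9 * (κ ^ 5 * (6 * s ^ 2 + 15)) := by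
    calc β ^ 9 * (y (β ^ 3) ^ 2 * β * (3 / 16))
        = β ^ 10 * (3 / 16) * (v (β ^ 3) * (κ * β)) ^ 5 * y (β ^ 3) ^ 2 := by rw [hvb]; ring
      _ = κ ^ 5 * (β ^ 15 * (3 / 8) * v (β ^ 3) ^ 5 / 2 * y (β ^ 3) ^ 2) := by ring
      _ ≤ κ ^ 5 * ((6 * s ^ 2 + 15) * β ^ 9) := by gcongr
      _ = _ := by ring
  have g7 := le_of_mul_le_mul_left g6 (by positivity)
  have : 0 ≤ κ ^ 5 * (6 * s ^ 2 + 15) := by positivity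
  linarith

section Algebra

open Polynomial

variable {L : ℝ[X] →ₗ[ℝ] ℝ} {p : ℕ → ℝ[X]}

theorem mem_span_of_degree_lt (hdeg : ∀ k, (p k).degree = k) {q : ℝ[X]} {k : ℕ}
    (hq : q.degree < k) : q ∈ Submodule.span ℝ (p '' Iio k) := by
  let S : Polynomial.Sequence ℝ := ⟨p, hdeg⟩
  have h := S.span_degreeLT (m := k) fun i _ =>
    (leadingCoeff_ne_zero.2 (S.ne_zero i)).isUnit
  have h1 : q ∈ degreeLT ℝ k := mem_degreeLT.2 hq
  rw [← h] at h1
  exact h1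

theorem orthonormal_apply_mul_eq_zero (hdeg : ∀ k, (p k).degree = k)
    (horth : ∀ k l, L (p k * p l) = if k = l then 1 else 0) {q : ℝ[X]} {k : ℕ}
    (hq : q.degree < k) : L (q * p k) = 0 := by
  have hmem := mem_span_of_degree_lt hdeg hq
  clear hq
  induction hmem using Submodule.span_induction with
  | mem x hx =>
    obtain ⟨j, hj, rfl⟩ := hx
    rw [horth, if_neg (ne_of_lt hj)]
  | zero => simp
  | add x y _ _ hx hy => rw [add_mul, map_add, hx, hy, add_zero]
  | smul a x _ hx => rw [smul_mul_assoc, map_smul, hx, smul_zero]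

theorem eq_zero_of_orthogonal (hdeg : ∀ k, (p k).degree = k)
    (horth : ∀ k l, L (p k * p l) = if k = l then 1 else 0) {q : ℝ[X]} {k : ℕ}
    (hq : q.degree < k) (h : ∀ j < k, L (q * p j) = 0) : q = 0 := by
  by_contra hne
  set d := q.natDegree with hd
  have hqd : q.degree = d := degree_eq_natDegree hne
  have hdk : d < k := by
    rw [hqd] at hq
    exact_mod_cast hq
  have hpd : (p d).leadingCoeff ≠ 0 := by
    intro h0
    have := hdeg d
    rw [leadingCoeff_eq_zero.1 h0] at this
    simp at this
  set c := q.leadingCoeff / (p d).leadingCoeff with hc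
  have hc0 : c ≠ 0 := div_ne_zero (leadingCoeff_ne_zero.2 hne) hpd
  have hlow : (q - C c * p d).degree < d := by
    rw [← hqd]
    apply degree_sub_lt_left _ hne
    · rw [leadingCoeff_mul, leadingCoeff_C, hc, div_mul_cancel₀ _ hpd]
    · rw [degree_C_mul hc0, hdeg, hqd]
  have h1 := orthonormal_apply_mul_eq_zero hdeg horth hlow
  rw [sub_mul, map_sub, h d hdk, mul_assoc, ← smul_eq_C_mul, map_smul, horth] at h1
  simp [hc0] at h1

/-- The coefficient of `x ^ (n - 2)` in the image of `x ^ n` under the Dunkl Laplacian, up to a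
multiple of the identity on odd polynomials. -/
noncomputable def dunklCoeff (σ : ℝ) (n : ℕ) : ℝ :=
  n * (n - 1) + 2 * σ * n - σ * (1 - (-1) ^ n)

/-- The Dunkl version of the Ornstein–Uhlenbeck operator on polynomials. -/
noncomputable def dunklOU (σ s : ℝ) : ℝ[X] →ₗ[ℝ] ℝ[X] :=
  lsum fun n => dunklCoeff σ n • monomial (n - 2) - (2 * s * n) • monomial n

theorem dunklCoeff_eq_zero (σ : ℝ) {n : ℕ} (hn : n < 2) : dunklCoeff σ n = 0 := by
  interval_cases n <;> simp [dunklCoeff]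
  ring

theorem dunklOU_monomial (σ s c : ℝ) (n : ℕ) : dunklOU σ s (monomial n c) =
    monomial (n - 2) (dunklCoeff σ n * c) - monomial n (2 * s * n * c) := by
  rw [dunklOU, lsum_apply, sum_monomial_index _ _ (by simp)]
  simp [smul_monomial]

theorem coeff_dunklOU (σ s : ℝ) (q : ℝ[X]) (m : ℕ) : (dunklOU σ s q).coeff m =
    dunklCoeff σ (m + 2) * q.coeff (m + 2) - 2 * s * m * q.coeff m := by
  induction q using Polynomial.induction_on' with
  | add q r hq hr => rw [map_add, coeff_add, hq, hr, coeff_add, coeff_add]; ring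
  | monomial n c =>
    rw [dunklOU_monomial, coeff_sub]
    simp only [coeff_monomial]
    by_cases hn : n < 2
    · rw [dunklCoeff_eq_zero σ hn, if_neg (by omega : n ≠ m + 2)]
      by_cases h : n = m <;> simp [h]
    · by_cases h : n = m
      · subst h
        simp [show n - 2 ≠ n by omega]
      · by_cases h' : n = m + 2
        · subst h'
          simp
        · simp [h, h', show n - 2 ≠ m by omega]

theorem dunklOU_symm {σ s : ℝ} (hodd : ∀ n : ℕ, Odd n → L (X ^ n) = 0)
    (heven : ∀ n : ℕ, Even n → 2 * s * L (X ^ (n + 2)) = (n + 1 + 2 * σ) * L (X ^ n)) (q r : ℝ[X]) :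
    L (dunklOU σ s q * r) = L (q * dunklOU σ s r) := by
  have hmon : ∀ (n : ℕ) (c : ℝ), L (monomial n c) = c * L (X ^ n) := fun n c => by
    rw [← C_mul_X_pow_eq_monomial, ← smul_eq_C_mul, map_smul, smul_eq_mul]
  induction q using Polynomial.induction_on' with
  | add q₁ q₂ h₁ h₂ => rw [map_add, add_mul, map_add, h₁, h₂, add_mul, map_add]
  | monomial i c =>
    induction r using Polynomial.induction_on' with
    | add r₁ r₂ h₁ h₂ => rw [map_add, mul_add, map_add, h₁, h₂, mul_add, map_add]
    | monomial j d =>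
      have hco : ∀ n, dunklCoeff σ n ≠ 0 → 2 ≤ n := fun n h => by
        by_contra! hn
        exact h (dunklCoeff_eq_zero σ hn)
      have h1 : dunklCoeff σ i * L (X ^ (i - 2 + j)) = dunklCoeff σ i * L (X ^ (i + j - 2)) := by
        by_cases h : dunklCoeff σ i = 0
        · simp [h]
        · rw [show i - 2 + j = i + j - 2 by have := hco i h; omega]
      have h2 : dunklCoeff σ j * L (X ^ (i + (j - 2))) = dunklCoeff σ j * L (X ^ (i + j - 2)) := by
        by_cases h : dunklCoeff σ j = 0
        · simp [h]
        · rw [show i + (j - 2) = i + j - 2 by have := hco j h; omega]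
      rw [dunklOU_monomial, dunklOU_monomial]
      simp only [sub_mul, mul_sub, monomial_mul_monomial, map_sub, hmon]
      suffices h : (dunklCoeff σ i - dunklCoeff σ j) * L (X ^ (i + j - 2))
          = ((i : ℝ) - j) * (2 * s * L (X ^ (i + j))) by
        linear_combination c * d * h1 - c * d * h2 + c * d * h
      rcases Nat.even_or_odd (i + j) with he | ho
      · rcases Nat.eq_zero_or_pos (i + j) with h0 | h0
        · obtain ⟨rfl, rfl⟩ : i = 0 ∧ j = 0 := by omega
          simp
        · obtain ⟨n, hn⟩ : ∃ n, i + j = n + 2 := ⟨i + j - 2, by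
            obtain ⟨t, ht⟩ := he
            omega⟩
          have hne : Even n := by
            rw [hn] at he
            simpa [Nat.even_add] using he
          rw [hn, heven n hne, Nat.add_sub_cancel]
          have hpar : (-1 : ℝ) ^ i = (-1) ^ j := by
            rw [neg_one_pow_eq_pow_mod_two, neg_one_pow_eq_pow_mod_two (n := j)]
            congr 1
            obtain ⟨t, ht⟩ := he
            omega
          have hcast : (n : ℝ) = i + j - 2 := by
            have : ((i + j : ℕ) : ℝ) = ((n + 2 : ℕ) : ℝ) := by rw [hn]
            push_cast at this
            linarith
          rw [dunklCoeff, dunklCoeff, hpar, hcast]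
          ring
      · rw [hodd _ ho]
        by_cases h2 : 2 ≤ i + j
        · rw [hodd _ (by obtain ⟨t, ht⟩ := ho; exact ⟨t - 1, by omega⟩)]
          simp
        · rw [dunklCoeff_eq_zero σ (by omega : i < 2), dunklCoeff_eq_zero σ (by omega : j < 2)]
          simp

theorem coeff_recurrence {σ s : ℝ} (hdeg : ∀ k, (p k).degree = k)
    (horth : ∀ k l, L (p k * p l) = if k = l then 1 else 0)
    (hodd : ∀ n : ℕ, Odd n → L (X ^ n) = 0)
    (heven : ∀ n : ℕ, Even n → 2 * s * L (X ^ (n + 2)) = (n + 1 + 2 * σ) * L (X ^ n)) (k n : ℕ) :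
    dunklCoeff σ (n + 2) * (p k).coeff (n + 2) = 2 * s * ((n : ℝ) - k) * (p k).coeff n := by
  have hz : ∀ k n, k < n → (p k).coeff n = 0 := fun k n h =>
    coeff_eq_zero_of_degree_lt (by rw [hdeg]; exact_mod_cast h)
  have hR : dunklOU σ s (p k) + C (2 * s * k) * p k = 0 := by
    refine eq_zero_of_orthogonal (k := k) hdeg horth ?_ ?_
    · rw [degree_lt_iff_coeff_zero]
      intro m hm
      rw [coeff_add, coeff_dunklOU, coeff_C_mul, hz k (m + 2) (by omega)]
      rcases hm.eq_or_lt with rfl | h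
      · ring
      · rw [hz k m h]
        ring
    · intro j hj
      rw [add_mul, map_add, dunklOU_symm hodd heven, mul_assoc, ← smul_eq_C_mul, map_smul, horth,
        if_neg hj.ne', smul_zero, add_zero, mul_comm]
      refine orthonormal_apply_mul_eq_zero hdeg horth ?_
      rw [degree_lt_iff_coeff_zero]
      intro m hm
      rw [coeff_dunklOU, hz j m (by omega), hz j (m + 2) (by omega)]
      ring
  have := congrArg (fun r => coeff r n) hR
  simp only [coeff_add, coeff_dunklOU, coeff_C_mul, coeff_zero] at this
  linarith

theorem coeff_eq_zero_of_odd_add {σ s : ℝ} (hs : 0 < s) (hdeg : ∀ k, (p k).degree = k)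
    {k : ℕ} (hrec : ∀ n : ℕ, dunklCoeff σ (n + 2) * (p k).coeff (n + 2)
      = 2 * s * ((n : ℝ) - k) * (p k).coeff n) {n : ℕ} (hn : Odd (n + k)) :
    (p k).coeff n = 0 := by
  have key : ∀ d n, k ≤ n + d → Odd (n + k) → (p k).coeff n = 0 := by
    intro d
    induction d with
    | zero =>
      intro n h ho
      have hnk : k ≠ n := by
        rintro rfl
        obtain ⟨t, ht⟩ := ho
        omega
      exact coeff_eq_zero_of_degree_lt (by rw [hdeg]; exact_mod_cast lt_of_le_of_ne h hnk)
    | succ d ih =>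
      intro n h ho
      have hnk : (n : ℝ) - k ≠ 0 := by
        rw [sub_ne_zero]
        intro e
        have e' : n = k := by exact_mod_cast e
        subst e'
        obtain ⟨t, ht⟩ := ho
        omega
      have h2 := ih (n + 2) (by omega) (by obtain ⟨t, ht⟩ := ho; exact ⟨t + 1, by omega⟩)
      have h3 := hrec n
      rw [h2, mul_zero] at h3
      exact (mul_eq_zero.1 h3.symm).resolve_left (by positivity)
  exact key k n (by omega) hn

/-- The differential equation of the generalized Hermite polynomials. -/
theorem eval_ode {σ s : ℝ} (hs : 0 < s) (hdeg : ∀ k, (p k).degree = k)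
    (horth : ∀ k l, L (p k * p l) = if k = l then 1 else 0)
    (hodd : ∀ n : ℕ, Odd n → L (X ^ n) = 0)
    (heven : ∀ n : ℕ, Even n → 2 * s * L (X ^ (n + 2)) = (n + 1 + 2 * σ) * L (X ^ n)) (k : ℕ) (x : ℝ) :
    x ^ 2 * (derivative (derivative (p k))).eval x + 2 * σ * x * (derivative (p k)).eval x
      - σ * (1 - (-1) ^ k) * (p k).eval x - 2 * s * x ^ 3 * (derivative (p k)).eval x
      + 2 * k * s * x ^ 2 * (p k).eval x = 0 := by
  have hrec := coeff_recurrence hdeg horth hodd heven k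
  have hpar := fun n => coeff_eq_zero_of_odd_add hs hdeg hrec (n := n)
  have hpar' : ∀ n, (-1 : ℝ) ^ k * (p k).coeff n = (-1) ^ n * (p k).coeff n := fun n => by
    rcases Nat.even_or_odd (n + k) with he | ho
    · congr 1
      rw [neg_one_pow_eq_pow_mod_two, neg_one_pow_eq_pow_mod_two (n := n)]
      congr 1
      obtain ⟨t, ht⟩ := he
      omega
    · rw [hpar n ho]
      simp
  have hpoly : X ^ 2 * derivative (derivative (p k)) + C (2 * σ) * (X ^ 1 * derivative (p k))
      - C (σ * (1 - (-1) ^ k)) * p k - C (2 * s) * (X ^ 3 * derivative (p k))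
      + C (2 * k * s) * (X ^ 2 * p k) = 0 := by
    ext n
    simp only [coeff_add, coeff_sub, coeff_C_mul, coeff_zero, coeff_X_pow_mul', coeff_derivative]
    have hp := hpar' n
    match n with
    | 0 =>
      have h : σ * (1 - (-1) ^ k) * (p k).coeff 0 = 0 := by linear_combination -σ * hp
      simpa using h
    | 1 =>
      norm_num at hp ⊢
      linear_combination σ * hp
    | 2 =>
      have h := hrec 0
      norm_num [dunklCoeff] at hp h ⊢
      linear_combination h + σ * hp
    | m + 3 =>
      have h := hrec (m + 1)
      rw [dunklCoeff] at h
      simp only [show m + 3 - 2 = m + 1 by omega, show m + 3 - 1 = m + 2 by omega,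
        show m + 3 - 3 = m by omega, show m + 1 + 2 = m + 3 by omega,
        show 2 ≤ m + 3 by omega, show 1 ≤ m + 3 by omega, show 3 ≤ m + 3 by omega,
        if_true, show m + 1 + 1 = m + 2 by omega] at h hp ⊢
      push_cast at h ⊢
      linear_combination h + σ * hp
  have := congrArg (eval x) hpoly
  simp only [eval_add, eval_sub, eval_mul, eval_pow, eval_X, eval_C, eval_zero] at this
  linarith

end Algebra

section Moments

open Polynomial

theorem integral_abs_rpow_mul_exp {s τ : ℝ} (hs : 0 < s) (hτ : -1 < τ) :
    ∫ x : ℝ, |x| ^ τ * Real.exp (-s * x ^ 2)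
      = s ^ (-(τ + 1) / 2) * Real.Gamma ((τ + 1) / 2) := by
  have h := integral_rpow_mul_exp_neg_mul_rpow (p := 2) two_pos hτ hs
  have h' := integral_comp_abs (f := fun x : ℝ => x ^ τ * Real.exp (-s * x ^ (2 : ℝ)))
  rw [h] at h'
  simp only [Real.rpow_two, sq_abs] at h'
  rw [h']
  ring

theorem integrable_abs_rpow_mul_exp {s τ : ℝ} (hs : 0 < s) (hτ : -1 < τ) :
    Integrable fun x : ℝ => |x| ^ τ * Real.exp (-s * x ^ 2) := by
  by_contra h
  have h1 := integral_abs_rpow_mul_exp hs hτ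
  rw [integral_undef h] at h1
  have : 0 < s ^ (-(τ + 1) / 2) * Real.Gamma ((τ + 1) / 2) :=
    mul_pos (Real.rpow_pos_of_pos hs _) (Real.Gamma_pos_of_pos (by linarith))
  linarith

theorem abs_pow_mul_abs_rpow {x : ℝ} (hx : x ≠ 0) (n : ℕ) (τ : ℝ) :
    |x| ^ n * |x| ^ τ = |x| ^ (n + τ) := by
  rw [Real.rpow_add (abs_pos.2 hx), Real.rpow_natCast]

theorem ae_ne_zero : ∀ᵐ x : ℝ, x ≠ 0 := by
  simp [ae_iff]

theorem integrable_eval_mul_weight {σ s : ℝ} (hσ : -(1/2) < σ) (hs : 0 < s) (q : ℝ[X]) :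
    Integrable fun x : ℝ => q.eval x * |x| ^ (2 * σ) * Real.exp (-s * x ^ 2) := by
  induction q using Polynomial.induction_on' with
  | add q r hq hr =>
    simp only [eval_add, add_mul]
    exact hq.add hr
  | monomial n c =>
    have h := integrable_abs_rpow_mul_exp (τ := n + 2 * σ) hs (by
      have : (0 : ℝ) ≤ n := n.cast_nonneg
      linarith)
    refine (h.const_mul c).mono (by simp only [eval_monomial]; fun_prop) ?_
    filter_upwards [ae_ne_zero] with x hx
    rw [← abs_pow_mul_abs_rpow hx]
    simp [mul_assoc]

/-- Integration of polynomials against the weight `|x|^(2σ) e^(-s x²)`. -/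
noncomputable def weightIntegral {σ s : ℝ} (hσ : -(1/2) < σ) (hs : 0 < s) : ℝ[X] →ₗ[ℝ] ℝ where
  toFun q := ∫ x : ℝ, q.eval x * |x| ^ (2 * σ) * Real.exp (-s * x ^ 2)
  map_add' q r := by
    simp only [eval_add, add_mul]
    exact integral_add (integrable_eval_mul_weight hσ hs q) (integrable_eval_mul_weight hσ hs r)
  map_smul' c q := by
    simp only [eval_smul, smul_eq_mul, mul_assoc, RingHom.id_apply]
    exact integral_const_mul _ _

theorem weightIntegral_apply {σ s : ℝ} (hσ : -(1/2) < σ) (hs : 0 < s) (q : ℝ[X]) :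
    weightIntegral hσ hs q = ∫ x : ℝ, q.eval x * |x| ^ (2 * σ) * Real.exp (-s * x ^ 2) := rfl

theorem weightIntegral_X_pow_odd {σ s : ℝ} (hσ : -(1/2) < σ) (hs : 0 < s) (n : ℕ) (hn : Odd n) :
    weightIntegral hσ hs (X ^ n) = 0 := by
  have h := integral_neg_eq_self
    (fun x : ℝ => (X ^ n : ℝ[X]).eval x * |x| ^ (2 * σ) * Real.exp (-s * x ^ 2)) volume
  simp only [eval_pow, eval_X, hn.neg_pow, abs_neg, even_two.neg_pow, neg_mul,
    integral_neg] at h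
  rw [weightIntegral_apply]
  simp only [eval_pow, eval_X, neg_mul]
  linarith

theorem weightIntegral_X_pow_even {σ s : ℝ} (hσ : -(1/2) < σ) (hs : 0 < s) (n : ℕ)
    (hn : Even n) : weightIntegral hσ hs (X ^ n)
      = s ^ (-(n + 2 * σ + 1) / 2) * Real.Gamma ((n + 2 * σ + 1) / 2) := by
  rw [weightIntegral_apply, ← integral_abs_rpow_mul_exp hs (by
    have : (0 : ℝ) ≤ n := n.cast_nonneg
    linarith)]
  refine integral_congr_ae ?_
  filter_upwards [ae_ne_zero] with x hx
  rw [← abs_pow_mul_abs_rpow hx, hn.pow_abs, eval_pow, eval_X]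

theorem weightIntegral_recurrence {σ s : ℝ} (hσ : -(1/2) < σ) (hs : 0 < s) (n : ℕ)
    (hn : Even n) : 2 * s * weightIntegral hσ hs (X ^ (n + 2))
      = (n + 1 + 2 * σ) * weightIntegral hσ hs (X ^ n) := by
  have h0 : (0 : ℝ) < (n + 2 * σ + 1) / 2 := by
    have : (0 : ℝ) ≤ n := n.cast_nonneg
    linarith
  rw [weightIntegral_X_pow_even hσ hs n hn,
    weightIntegral_X_pow_even hσ hs (n + 2) (by simpa [Nat.even_add] using hn)]
  push_cast
  rw [show ((n : ℝ) + 2 + 2 * σ + 1) / 2 = (n + 2 * σ + 1) / 2 + 1 by ring,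
    Real.Gamma_add_one h0.ne', show -((n : ℝ) + 2 + 2 * σ + 1) / 2 = -(n + 2 * σ + 1) / 2 - 1 by ring,
    Real.rpow_sub_one hs.ne']
  field_simp
  ring

end Moments

/-- Gaussian decay beats polynomial growth. -/
theorem tendsto_rpow_mul_eval_mul_exp (q : Polynomial ℝ) {c : ℝ} (hc : 0 < c) (τ : ℝ) :
    Filter.Tendsto (fun x : ℝ => x ^ τ * (q.eval x * Real.exp (-c * x ^ 2)))
      Filter.atTop (nhds 0) := by
  induction q using Polynomial.induction_on' with
  | add q r hq hr =>
    simpa only [Polynomial.eval_add, add_mul, mul_add, add_zero] using hq.add hr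
  | monomial n a =>
    have h1 : Filter.Tendsto (fun x : ℝ => Real.exp (-(1 / 2) * x)) Filter.atTop (nhds 0) := by
      simpa using tendsto_rpow_mul_exp_neg_mul_atTop_nhds_zero 0 (1 / 2) (by norm_num)
    have h2 := ((rpow_mul_exp_neg_mul_sq_isLittleO_exp_neg hc (τ + n)).trans_tendsto h1).const_mul a
    rw [mul_zero] at h2
    refine h2.congr' ?_
    filter_upwards [Filter.eventually_gt_atTop 0] with x hx
    rw [Polynomial.eval_monomial, Real.rpow_add hx, Real.rpow_natCast]
    ring

section HermiteFunction

open Polynomial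

/-- The derivative of `x ^ σ * P x * exp (-s x² / 2)` on the positive half-line. -/
noncomputable def xiDeriv (σ s : ℝ) (P : ℝ[X]) (x : ℝ) : ℝ :=
  x ^ σ * Real.exp (-s * x ^ 2 / 2) * ((derivative P).eval x + (σ / x - s * x) * P.eval x)

theorem hasDerivAt_rpow_mul_exp (σ s : ℝ) {x : ℝ} (hx : 0 < x) :
    HasDerivAt (fun t : ℝ => t ^ σ * Real.exp (-s * t ^ 2 / 2))
      ((σ / x - s * x) * (x ^ σ * Real.exp (-s * x ^ 2 / 2))) x := by
  have h1 := Real.hasDerivAt_rpow_const (x := x) (p := σ) (Or.inl hx.ne')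
  have h2 := ((((hasDerivAt_id' x).fun_pow 2).const_mul (-s)).div_const 2).exp
  refine (h1.fun_mul h2).congr_deriv ?_
  rw [Real.rpow_sub_one hx.ne']
  field_simp
  norm_num
  ring

theorem hasDerivAt_xiF (σ s : ℝ) (p : ℕ → ℝ[X]) (k : ℕ) {x : ℝ} (hx : 0 < x) :
    HasDerivAt (xiF σ s p k) (xiDeriv σ s (p k) x) x := by
  have h := (hasDerivAt_rpow_mul_exp σ s hx).fun_mul ((p k).hasDerivAt x)
  refine (h.congr_deriv ?_).congr_of_eventuallyEq ?_
  · rw [xiDeriv]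
    ring
  · filter_upwards [lt_mem_nhds hx] with t ht
    rw [xiF, abs_of_pos ht]
    ring

theorem hasDerivAt_xiDeriv {σ s : ℝ} {p : ℕ → ℝ[X]} {k : ℕ} {x : ℝ} (hx : 0 < x)
    (hode : x ^ 2 * (derivative (derivative (p k))).eval x
      + 2 * σ * x * (derivative (p k)).eval x
      - σ * (1 - (-1) ^ k) * (p k).eval x - 2 * s * x ^ 3 * (derivative (p k)).eval x
      + 2 * k * s * x ^ 2 * (p k).eval x = 0) :
    HasDerivAt (xiDeriv σ s (p k))
      ((s ^ 2 * x ^ 2 - s * (2 * k + 1 + 2 * σ) + σ * (σ - (-1) ^ k) / x ^ 2)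
        * xiF σ s p k x) x := by
  have h1 := ((hasDerivAt_inv hx.ne').const_mul σ).fun_sub ((hasDerivAt_id' x).const_mul s)
  have h2 := (hasDerivAt_rpow_mul_exp σ s hx).fun_mul
    (((derivative (p k)).hasDerivAt x).fun_add (h1.fun_mul ((p k).hasDerivAt x)))
  simp only [← div_eq_mul_inv] at h2
  refine h2.congr_deriv ?_
  rw [xiF, abs_of_pos hx]
  have hode' : (derivative (derivative (p k))).eval x
      = (σ * (1 - (-1) ^ k) / x ^ 2 - 2 * k * s) * (p k).eval x
        - 2 * (σ / x - s * x) * (derivative (p k)).eval x := by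
    field_simp
    linear_combination hode
  rw [hode']
  field_simp
  ring

theorem xiF_sq (σ s : ℝ) (p : ℕ → ℝ[X]) (k : ℕ) (x : ℝ) : xiF σ s p k x ^ 2 =
    (p k).eval x * (p k).eval x * |x| ^ (2 * σ) * Real.exp (-s * x ^ 2) := by
  have h1 : |x| ^ (2 * σ) = (|x| ^ σ) ^ 2 := by
    rw [mul_comm, Real.rpow_mul (abs_nonneg x), Real.rpow_two]
  have h2 : Real.exp (-s * x ^ 2) = Real.exp (-s * x ^ 2 / 2) ^ 2 := by
    rw [← Real.exp_nat_mul]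
    congr 1
    push_cast
    ring
  rw [h1, h2, xiF]
  ring

theorem integral_xiF_sq_le_one {σ s : ℝ} {p : ℕ → ℝ[X]} {k : ℕ}
    (h : ∫ x : ℝ, xiF σ s p k x ^ 2 = 1) {a b : ℝ} (hab : a ≤ b) :
    ∫ x in a..b, xiF σ s p k x ^ 2 ≤ 1 := by
  have hi : Integrable fun x => xiF σ s p k x ^ 2 := by
    by_contra hn
    rw [integral_undef hn] at h
    exact zero_ne_one h
  rw [intervalIntegral.integral_of_le hab, ← h]
  exact setIntegral_le_integral hi (Filter.Eventually.of_forall fun x => sq_nonneg _)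

theorem tendsto_xiF {σ s : ℝ} (hs : 0 < s) (p : ℕ → ℝ[X]) (k : ℕ) :
    Filter.Tendsto (xiF σ s p k) Filter.atTop (nhds 0) := by
  refine (tendsto_rpow_mul_eval_mul_exp (p k) (half_pos hs) σ).congr' ?_
  filter_upwards [Filter.eventually_gt_atTop 0] with x hx
  rw [xiF, abs_of_pos hx]
  congr 3
  ring

theorem eventually_xiF_pos (σ s : ℝ) {p : ℕ → ℝ[X]} {k : ℕ} (hk : 1 ≤ k)
    (hdeg : (p k).degree = k) (hlead : 0 < (p k).leadingCoeff) :
    ∀ᶠ x in Filter.atTop, 0 < xiF σ s p k x := by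
  have h := (p k).tendsto_atTop_of_leadingCoeff_nonneg
    (by rw [hdeg]; exact_mod_cast hk) hlead.le
  filter_upwards [h.eventually_gt_atTop 0, Filter.eventually_gt_atTop 0] with x h1 h2
  rw [xiF, abs_of_pos h2]
  exact mul_pos (Real.rpow_pos_of_pos h2 _) (mul_pos h1 (Real.exp_pos _))

end HermiteFunction

section TurningPoint

variable {σ s : ℝ} {k : ℕ}

theorem sq_le_discr (hσ : -(1/2) < σ) (hk : 1 ≤ k) :
    (k : ℝ) ^ 2 ≤ (2 * k + 1 + 2 * σ) ^ 2 - 4 * (σ * (σ - (-1 : ℝ) ^ k)) := by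
  have hk' : (1 : ℝ) ≤ k := by exact_mod_cast hk
  rcases Nat.even_or_odd k with h | h
  · rw [h.neg_one_pow]
    nlinarith
  · rw [h.neg_one_pow]
    nlinarith

theorem discr_le (hk : 1 ≤ k) :
    (2 * k + 1 + 2 * σ) ^ 2 - 4 * (σ * (σ - (-1 : ℝ) ^ k)) ≤ ((3 + 3 * |σ|) * k) ^ 2 := by
  have hk' : (1 : ℝ) ≤ k := by exact_mod_cast hk
  have h1 : (2 * k + 1 : ℝ) ^ 2 ≤ (3 * k) ^ 2 := by nlinarith
  have h2 : σ * k ≤ |σ| * k := mul_le_mul_of_nonneg_right (le_abs_self σ) (by linarith)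
  have h3 : |σ| * k ≤ |σ| * (k * k) := mul_le_mul_of_nonneg_left (by nlinarith) (abs_nonneg σ)
  have h4 : |σ| ≤ |σ| * k := le_mul_of_one_le_right (abs_nonneg σ) hk'
  have h5 := le_abs_self σ
  have h6 : 0 ≤ |σ| ^ 2 * k ^ 2 := by positivity
  have h7 : 0 ≤ |σ| * (k * k) := by positivity
  rcases Nat.even_or_odd k with h | h
  · rw [h.neg_one_pow]
    linarith
  · rw [h.neg_one_pow]
    linarith

theorem two_mul_le_add (hσ : -(1/2) < σ) : (2 * k : ℝ) ≤ 2 * k + 1 + 2 * σ := by linarith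

theorem bk_sq (hσ : -(1/2) < σ) (hs : 0 < s) : bk σ s k ^ 2 = (2 * k + 1 + 2 * σ +
    Real.sqrt ((2 * k + 1 + 2 * σ) ^ 2 - 4 * (σ * (σ - (-1 : ℝ) ^ k)))) / (2 * s) := by
  have := two_mul_le_add (k := k) hσ
  have : (0 : ℝ) ≤ k := k.cast_nonneg
  rw [bk, Real.sq_sqrt (div_nonneg (add_nonneg (by linarith) (Real.sqrt_nonneg _)) (by linarith))]

theorem div_le_bk_sq (hσ : -(1/2) < σ) (hs : 0 < s) : k / s ≤ bk σ s k ^ 2 := by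
  rw [bk_sq hσ hs, div_le_div_iff₀ hs (by positivity)]
  have := two_mul_le_add (k := k) hσ
  have := Real.sqrt_nonneg ((2 * k + 1 + 2 * σ) ^ 2 - 4 * (σ * (σ - (-1 : ℝ) ^ k)))
  nlinarith

theorem bk_pos (hσ : -(1/2) < σ) (hs : 0 < s) (hk : 1 ≤ k) : 0 < bk σ s k := by
  have h0 : (0 : ℝ) < k := by exact_mod_cast hk
  have h1 : 0 < bk σ s k ^ 2 := (div_pos h0 hs).trans_le (div_le_bk_sq hσ hs)
  exact lt_of_le_of_ne (Real.sqrt_nonneg _) fun h => by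
    rw [← h] at h1
    simp at h1

theorem bk_sq_le (hσ : -(1/2) < σ) (hs : 0 < s) (hk : 1 ≤ k) :
    bk σ s k ^ 2 ≤ (6 + 5 * |σ|) * k / (2 * s) := by
  have hk' : (1 : ℝ) ≤ k := by exact_mod_cast hk
  rw [bk_sq hσ hs]
  have h1 : √((2 * k + 1 + 2 * σ) ^ 2 - 4 * (σ * (σ - (-1 : ℝ) ^ k))) ≤ (3 + 3 * |σ|) * k :=
    Real.sqrt_le_iff.2 ⟨by positivity, discr_le hk⟩
  have h4 : |σ| ≤ |σ| * k := le_mul_of_one_le_right (abs_nonneg σ) hk'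
  have h5 := le_abs_self σ
  gcongr
  linarith

theorem bk_lt_succ (hσ : -(1/2) < σ) (hs : 0 < s) (hk : 1 ≤ k) : bk σ s k < bk σ s (k + 1) := by
  have hk' : (1 : ℝ) ≤ k := by exact_mod_cast hk
  have h : bk σ s k ^ 2 < bk σ s (k + 1) ^ 2 := by
    rw [bk_sq hσ hs, bk_sq hσ hs]
    apply div_lt_div_of_pos_right _ (by positivity)
    apply add_lt_add_of_lt_of_le
    · push_cast
      linarith
    · apply Real.sqrt_le_sqrt
      rw [pow_succ (-1 : ℝ) k]
      push_cast
      rcases Nat.even_or_odd k with h | h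
      · rw [h.neg_one_pow]
        nlinarith
      · rw [h.neg_one_pow]
        nlinarith
  exact lt_of_pow_lt_pow_left₀ 2 (Real.sqrt_nonneg _) h

theorem two_mul_bk_sq_sub (hσ : -(1/2) < σ) (hs : 0 < s) :
    2 * s * bk σ s k ^ 2 - (2 * k + 1 + 2 * σ)
      = √((2 * k + 1 + 2 * σ) ^ 2 - 4 * (σ * (σ - (-1 : ℝ) ^ k))) := by
  rw [bk_sq hσ hs]
  field_simp
  ring

theorem bk_equation (hσ : -(1/2) < σ) (hs : 0 < s) (hk : 1 ≤ k) :
    s ^ 2 * bk σ s k ^ 4 - (2 * k + 1 + 2 * σ) * s * bk σ s k ^ 2 + σ * (σ - (-1) ^ k) = 0 := by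
  have h := Real.sq_sqrt ((sq_nonneg (k : ℝ)).trans (sq_le_discr hσ hk))
  rw [← two_mul_bk_sq_sub hσ hs] at h
  linear_combination h / 4

theorem potential_eq (hσ : -(1/2) < σ) (hs : 0 < s) (hk : 1 ≤ k) (x : ℝ) :
    s ^ 2 * x ^ 2 - s * (2 * k + 1 + 2 * σ) + σ * (σ - (-1) ^ k) / x ^ 2
      = -(s ^ 2 * (bk σ s k ^ 2 - x ^ 2) + σ * (σ - (-1) ^ k) / bk σ s k ^ 2
        - σ * (σ - (-1) ^ k) / x ^ 2) := by
  have hb := bk_pos hσ hs hk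
  have h := bk_equation hσ hs hk
  have h' : σ * (σ - (-1) ^ k) / bk σ s k ^ 2
      = (2 * k + 1 + 2 * σ) * s - s ^ 2 * bk σ s k ^ 2 := by
    rw [div_eq_iff (by positivity)]
    linear_combination h
  rw [h']
  ring

/-- Beyond the turning point the potential grows at least linearly, with slope of order `√k`. -/
theorem potential_lower_bound (hσ : -(1/2) < σ) (hs : 0 < s) (hk : 1 ≤ k) {x : ℝ}
    (hx : bk σ s k ≤ x) :
    2 * s ^ 2 / (6 + 5 * |σ|) * √(k / s) * (x - bk σ s k)
      ≤ s ^ 2 * x ^ 2 - s * (2 * k + 1 + 2 * σ) + σ * (σ - (-1) ^ k) / x ^ 2 := by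
  have hk' : (1 : ℝ) ≤ k := by exact_mod_cast hk
  rw [potential_eq hσ hs hk]
  set τ := σ * (σ - (-1) ^ k) with hτ
  have hb := bk_pos hσ hs hk
  have heq := bk_equation hσ hs hk
  have hsub := two_mul_bk_sq_sub (k := k) hσ hs
  have hup := bk_sq_le hσ hs hk
  have hlo : √(k / s) ≤ bk σ s k := Real.sqrt_le_iff.2 ⟨hb.le, div_le_bk_sq hσ hs⟩
  have hD : (k : ℝ) ≤ 2 * s * bk σ s k ^ 2 - (2 * k + 1 + 2 * σ) := by
    rw [hsub]
    exact Real.le_sqrt_of_sq_le (sq_le_discr hσ hk)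
  rw [← hτ] at heq
  set b := bk σ s k with hbdef
  have hx0 : 0 < x := hb.trans_le hx
  have hA : 0 < 6 + 5 * |σ| := by positivity
  have hfac : -(s ^ 2 * (b ^ 2 - x ^ 2) + τ / b ^ 2 - τ / x ^ 2)
      = (s ^ 2 - τ / (b ^ 2 * x ^ 2)) * (x ^ 2 - b ^ 2) := by
    field_simp
    ring
  rw [hfac]
  have hc : 2 * s ^ 2 / (6 + 5 * |σ|) ≤ s ^ 2 - τ / (b ^ 2 * x ^ 2) := by
    rcases le_total τ 0 with h | h
    · have h1 : τ / (b ^ 2 * x ^ 2) ≤ 0 := div_nonpos_of_nonpos_of_nonneg h (by positivity)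
      have h2 : 2 * s ^ 2 / (6 + 5 * |σ|) ≤ s ^ 2 := by
        rw [div_le_iff₀ hA]
        nlinarith [sq_nonneg s, mul_nonneg (sq_nonneg s) (abs_nonneg σ)]
      linarith
    · have h1 : τ / (b ^ 2 * x ^ 2) ≤ τ / (b ^ 2 * b ^ 2) := by gcongr
      have h2 : s ^ 2 - τ / (b ^ 2 * b ^ 2)
          = s * (2 * s * b ^ 2 - (2 * k + 1 + 2 * σ)) / b ^ 2 := by
        field_simp
        linear_combination (-1 : ℝ) * heq
      have h3 : 2 * s ^ 2 / (6 + 5 * |σ|) ≤ s * (2 * s * b ^ 2 - (2 * k + 1 + 2 * σ)) / b ^ 2 := by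
        rw [div_le_div_iff₀ hA (by positivity)]
        rw [le_div_iff₀ (by positivity)] at hup
        calc 2 * s ^ 2 * b ^ 2 = s * (b ^ 2 * (2 * s)) := by ring
          _ ≤ s * ((6 + 5 * |σ|) * k) := by gcongr
          _ = s * k * (6 + 5 * |σ|) := by ring
          _ ≤ _ := by gcongr
      linarith
  have hxb : √(k / s) * (x - b) ≤ x ^ 2 - b ^ 2 := by
    have h1 : √(k / s) * (x - b) ≤ b * (x - b) :=
      mul_le_mul_of_nonneg_right hlo (sub_nonneg.2 hx)
    nlinarith
  rw [mul_assoc]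
  exact mul_le_mul hc hxb (mul_nonneg (Real.sqrt_nonneg _) (sub_nonneg.2 hx))
    (le_trans (by positivity) hc)

end TurningPoint

section Decay

variable {σ s : ℝ} {p : ℕ → Polynomial ℝ}

theorem weightIntegral_mul (hσ : -(1/2) < σ) (hs : 0 < s) (q r : Polynomial ℝ) :
    weightIntegral hσ hs (q * r)
      = ∫ x : ℝ, q.eval x * r.eval x * |x| ^ (2 * σ) * Real.exp (-s * x ^ 2) := by
  simp only [weightIntegral_apply, Polynomial.eval_mul]

theorem xiF_ode (hσ : -(1/2) < σ) (hs : 0 < s) (hdeg : ∀ k, (p k).degree = k)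
    (horth : ∀ k l, (∫ x : ℝ,
        (p k).eval x * (p l).eval x * |x| ^ (2 * σ) * Real.exp (-s * x ^ 2)) =
        if k = l then 1 else 0) (k : ℕ) {x : ℝ} (hx : 0 < x) :
    HasDerivAt (xiDeriv σ s (p k))
      ((s ^ 2 * x ^ 2 - s * (2 * k + 1 + 2 * σ) + σ * (σ - (-1) ^ k) / x ^ 2)
        * xiF σ s p k x) x :=
  hasDerivAt_xiDeriv hx (eval_ode hs hdeg
    (fun k l => (weightIntegral_mul hσ hs _ _).trans (horth k l))
    (weightIntegral_X_pow_odd hσ hs) (weightIntegral_recurrence hσ hs) k x)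

theorem xiF_decay (hσ : -(1/2) < σ) (hs : 0 < s) (hdeg : ∀ k, (p k).degree = k)
    (hlead : ∀ k, 0 < (p k).leadingCoeff)
    (horth : ∀ k l, (∫ x : ℝ,
        (p k).eval x * (p l).eval x * |x| ^ (2 * σ) * Real.exp (-s * x ^ 2)) =
        if k = l then 1 else 0) {k : ℕ} (hk : 1 ≤ k) :
    xiF σ s p k (bk σ s k) * xiDeriv σ s (p k) (bk σ s k) ≤ 0 ∧
      ∀ x, bk σ s k ≤ x → 0 < xiF σ s p k x ∧
        xiF σ s p k x * (1 + 2 * s ^ 2 / (6 + 5 * |σ|) * √(k / s) * (x - bk σ s k) ^ 3 / 3)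
          ≤ xiF σ s p k (bk σ s k) := by
  have hb := bk_pos hσ hs hk
  exact decay_of_convex_ode (by positivity)
    (fun x hx => hasDerivAt_xiF σ s p k (hb.trans_le hx))
    (fun x hx => xiF_ode hσ hs hdeg horth k (hb.trans_le hx))
    (fun x hx => potential_lower_bound hσ hs hk hx)
    (tendsto_xiF hs p k) (eventually_xiF_pos σ s hk (hdeg k) (hlead k))

theorem abs_mul_sub_neg_one_pow_le (σ : ℝ) (k : ℕ) :
    |σ * (σ - (-1) ^ k)| ≤ |σ| * (|σ| + 1) := by
  rw [abs_mul]
  refine mul_le_mul_of_nonneg_left ((abs_sub _ _).trans ?_) (abs_nonneg σ)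
  simp

theorem xiF_bk_sq_mul_le (hσ : -(1/2) < σ) (hs : 0 < s) (hdeg : ∀ k, (p k).degree = k)
    (hlead : ∀ k, 0 < (p k).leadingCoeff)
    (horth : ∀ k l, (∫ x : ℝ,
        (p k).eval x * (p l).eval x * |x| ^ (2 * σ) * Real.exp (-s * x ^ 2)) =
        if k = l then 1 else 0) {k : ℕ} (hk : 1 ≤ k)
    (hk1 : s * (1 + 4 / s) ^ 3 ≤ k) (hk2 : 64 * (|σ| * (|σ| + 1)) / s ≤ k)
    {β : ℝ} (hβ0 : 0 ≤ β) (hβ : β ^ 3 = bk σ s k) :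
    xiF σ s p k (bk σ s k) ^ 2 * β ≤ 6 * (1 + 4 / s) ^ 5 * (6 * s ^ 2 + 15) := by
  have hκ : 1 ≤ 1 + 4 / s := by
    have : 0 < 4 / s := by positivity
    linarith
  have hβ6 : β ^ 6 = bk σ s k ^ 2 := by rw [← hβ]; ring
  have hβ6' : k / s ≤ β ^ 6 := hβ6 ▸ div_le_bk_sq hσ hs
  have hβ2 : 1 + 4 / s ≤ β ^ 2 := by
    have : (1 + 4 / s) ^ 3 ≤ (β ^ 2) ^ 3 := by
      rw [← pow_mul]
      refine le_trans ?_ hβ6'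
      rw [le_div_iff₀ hs]
      linarith
    exact le_of_pow_le_pow_left₀ three_ne_zero (by positivity) this
  have hβ1 : 1 ≤ β := by
    by_contra! h
    nlinarith
  rw [← hβ]
  refine sq_turning_point_le (y := xiF σ s p k) (z := xiDeriv σ s (p k))
    (τ := σ * (σ - (-1) ^ k)) hβ1 hκ ?_ hβ2 ?_
    (fun x hx => hasDerivAt_xiF σ s p k hx) (fun x hx => ?_) ?_ ?_
  · have h4 : (4 : ℝ) ≤ s * (1 + 4 / s) := by
      have : s * (1 + 4 / s) = s + 4 := by field_simp
      linarith
    have h5 : (4 : ℝ) ≤ s * (1 + 4 / s) ^ 2 := by nlinarith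
    nlinarith
  · rw [div_le_iff₀ hs] at hk2
    rw [div_le_iff₀ hs] at hβ6'
    have := abs_mul_sub_neg_one_pow_le σ k
    nlinarith
  · rw [hβ6, ← neg_mul, ← potential_eq hσ hs hk]
    exact xiF_ode hσ hs hdeg horth k hx
  · rw [hβ]
    exact (xiF_decay hσ hs hdeg hlead horth hk).1
  · refine integral_xiF_sq_le_one ?_ (by linarith [pow_pos (zero_lt_one.trans_le hβ1) 3])
    simp only [xiF_sq]
    simpa using horth k k

theorem exists_xiF_bk_le (hσ : -(1/2) < σ) (hs : 0 < s) (hdeg : ∀ k, (p k).degree = k)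
    (hlead : ∀ k, 0 < (p k).leadingCoeff)
    (horth : ∀ k l, (∫ x : ℝ,
        (p k).eval x * (p l).eval x * |x| ^ (2 * σ) * Real.exp (-s * x ^ 2)) =
        if k = l then 1 else 0) :
    ∃ C > 0, ∀ k : ℕ, 1 ≤ k → xiF σ s p k (bk σ s k) ≤ C * (k : ℝ) ^ (-(1/12) : ℝ) := by
  have hb : BddAbove (range fun k : ℕ => xiF σ s p k (bk σ s k) * (k : ℝ) ^ (1/12 : ℝ)) := by
    refine Filter.IsBoundedUnder.bddAbove_range
      ⟨s ^ (1/12 : ℝ) * √(6 * (1 + 4 / s) ^ 5 * (6 * s ^ 2 + 15)), ?_⟩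
    rw [Filter.eventually_map]
    have hlim := tendsto_natCast_atTop_atTop (R := ℝ)
    filter_upwards [Filter.eventually_ge_atTop 1, hlim.eventually_ge_atTop _,
      hlim.eventually_ge_atTop _] with k hk hk1 hk2
    have hbk := bk_pos hσ hs hk
    have hβ0 : 0 ≤ bk σ s k ^ (1/3 : ℝ) := by positivity
    have hβ : (bk σ s k ^ (1/3 : ℝ)) ^ 3 = bk σ s k := by
      rw [← Real.rpow_natCast, ← Real.rpow_mul hbk.le]
      norm_num
    have h := xiF_bk_sq_mul_le hσ hs hdeg hlead horth hk hk1 hk2 hβ0 hβ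
    have hpos := ((xiF_decay hσ hs hdeg hlead horth hk).2 _ le_rfl).1
    have hk12 : (k : ℝ) ^ (1/12 : ℝ) ≤ s ^ (1/12 : ℝ) * √(bk σ s k ^ (1/3 : ℝ)) := by
      have h1 : (k : ℝ) ≤ s * bk σ s k ^ 2 := by
        have := div_le_bk_sq (k := k) hσ hs
        rw [div_le_iff₀ hs] at this
        linarith
      refine (Real.rpow_le_rpow k.cast_nonneg h1 (by norm_num)).trans_eq ?_
      rw [Real.mul_rpow hs.le (by positivity), Real.sqrt_eq_rpow, ← Real.rpow_natCast,
        ← Real.rpow_mul hbk.le, ← Real.rpow_mul hbk.le]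
      norm_num
    calc xiF σ s p k (bk σ s k) * (k : ℝ) ^ (1/12 : ℝ)
        ≤ xiF σ s p k (bk σ s k) * (s ^ (1/12 : ℝ) * √(bk σ s k ^ (1/3 : ℝ))) :=
          mul_le_mul_of_nonneg_left hk12 hpos.le
      _ = s ^ (1/12 : ℝ) * √(xiF σ s p k (bk σ s k) ^ 2 * bk σ s k ^ (1/3 : ℝ)) := by
          rw [Real.sqrt_mul (sq_nonneg _), Real.sqrt_sq hpos.le]
          ring
      _ ≤ _ := by gcongr
  obtain ⟨C, hC⟩ := hb
  refine ⟨max C 1, by positivity, fun k hk => ?_⟩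
  have hk0 : (0 : ℝ) < k := by exact_mod_cast hk
  rw [Real.rpow_neg hk0.le, ← div_eq_mul_inv, le_div_iff₀ (by positivity)]
  exact (hC ⟨k, rfl⟩).trans (le_max_left _ _)

end Decay

theorem xi_decay_beyond_oscillation (σ s : ℝ) (hσ : -(1/2) < σ) (hs : 0 < s)
    (p : ℕ → Polynomial ℝ)
    (hdeg : ∀ k, (p k).degree = k)
    (hlead : ∀ k, 0 < (p k).leadingCoeff)
    (horth : ∀ k l, (∫ x : ℝ,
        (p k).eval x * (p l).eval x * |x| ^ (2 * σ) * Real.exp (-s * x ^ 2)) =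
        if k = l then 1 else 0) :
    ∃ F > (0 : ℝ), ∀ k : ℕ, 1 ≤ k → ∀ x : ℝ, bk σ s (k + 1) ≤ x →
      xiF σ s p k x ≤ F * (k : ℝ) ^ (-(5/12) : ℝ) / (x - bk σ s k) ^ 2 := by
  obtain ⟨C, hC0, hC⟩ := exists_xiF_bk_le hσ hs hdeg hlead horth
  obtain ⟨d, hd0, hd⟩ : ∃ d > 0, d ^ 3 = 2 * s ^ 2 / (6 + 5 * |σ|) / √s := by
    refine ⟨(2 * s ^ 2 / (6 + 5 * |σ|) / √s) ^ (1/3 : ℝ), by positivity, ?_⟩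
    rw [← Real.rpow_natCast, ← Real.rpow_mul (by positivity)]
    norm_num
  refine ⟨3 * C / d ^ 2, by positivity, fun k hk x hx => ?_⟩
  have hk0 : (0 : ℝ) < k := by exact_mod_cast hk
  have hh : 0 < x - bk σ s k := sub_pos.2 ((bk_lt_succ hσ hs hk).trans_le hx)
  obtain ⟨hpos, hdecay⟩ := (xiF_decay hσ hs hdeg hlead horth hk).2 x (sub_pos.1 hh).le
  obtain ⟨m, hm0, hm3, hm2⟩ : ∃ m > 0, m ^ 3 = √(k : ℝ) ∧
      (k : ℝ) ^ (-(1/12) : ℝ) = m ^ 2 * (k : ℝ) ^ (-(5/12) : ℝ) := by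
    refine ⟨(k : ℝ) ^ (1/6 : ℝ), by positivity, ?_, ?_⟩
    · rw [← Real.rpow_natCast, ← Real.rpow_mul hk0.le, Real.sqrt_eq_rpow]
      norm_num
    · rw [← Real.rpow_natCast, ← Real.rpow_mul hk0.le, ← Real.rpow_add hk0]
      norm_num
  have hκ : 2 * s ^ 2 / (6 + 5 * |σ|) * √(k / s) = (d * m) ^ 3 := by
    rw [mul_pow, hd, hm3, Real.sqrt_div hk0.le]
    ring
  rw [hκ, ← mul_pow] at hdecay
  have ht : ∀ t : ℝ, 0 ≤ t → t ^ 2 ≤ 3 * (1 + t ^ 3 / 3) := fun t ht => by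
    nlinarith [mul_nonneg ht (sq_nonneg (t - 1)), sq_nonneg (t - 1)]
  have hC' := hC k hk
  rw [hm2] at hC'
  have hmain : m ^ 2 * (xiF σ s p k x * (d * (x - bk σ s k)) ^ 2)
      ≤ m ^ 2 * (3 * C * (k : ℝ) ^ (-(5/12) : ℝ)) := by
    have := mul_le_mul_of_nonneg_left (ht (d * m * (x - bk σ s k)) (by positivity)) hpos.le
    calc _ = xiF σ s p k x * (d * m * (x - bk σ s k)) ^ 2 := by ring
      _ ≤ _ := by linarith
  have hmain' := le_of_mul_le_mul_left hmain (by positivity)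
  rw [le_div_iff₀ (by positivity), div_mul_eq_mul_div, le_div_iff₀ (by positivity)]
  linarith
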